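/- Let n ≥ 1 and α > -n. There exist constants C > 0 and c > 0 such that for all x, y ∈ ℝⁿ with x ≠ y and all t > 0, |L_α(x,y;t)| ≤ C e^{-c|x-y|²} / |x-y|^{n - 1/2}. Consequently, ∫_{ℝⁿ} sup_{t>0} |L_α(x,y;t)| dx is bounded uniformly in y ∈ ℝⁿ. -/

import Mathlib

open Real MeasureTheory Set

/-- The Mehler (Hermite heat) kernel on ℝⁿ. -/
noncomputable def W (n : ℕ) (s : ℝ) (x y : EuclideanSpace ℝ (Fin n)) : ℝ :=
  (Real.exp (-2 * s) / (Real.pi * (1 - Real.exp (-4 * s)))) ^ ((n : ℝ) / 2) *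
    Real.exp (-(1 / 4) * ((1 + Real.exp (-2 * s)) / (1 - Real.exp (-2 * s)) * ‖x - y‖ ^ 2 +
      (1 - Real.exp (-2 * s)) / (1 + Real.exp (-2 * s)) * ‖x + y‖ ^ 2))

/-- The Hermite-Poisson kernel. -/
noncomputable def P (n : ℕ) (t : ℝ) (x y : EuclideanSpace ℝ (Fin n)) : ℝ :=
  t / Real.sqrt (4 * Real.pi) *
    ∫ s in Set.Ioi (0 : ℝ), s ^ (-(3 : ℝ) / 2) * Real.exp (-t ^ 2 / (4 * s)) * W n s x y

/-- The kernel of the difference of Poisson semigroups P_t^{L+α} - P_t^L. -/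
noncomputable def Lker (n : ℕ) (α : ℝ) (x y : EuclideanSpace ℝ (Fin n)) (t : ℝ) : ℝ :=
  t / Real.sqrt (4 * Real.pi) *
    ∫ u in Set.Ioi (0 : ℝ), u ^ (-(3 : ℝ) / 2) * Real.exp (-t ^ 2 / (4 * u)) *
      (Real.exp (-α * u) - 1) * W n u x y

/-- The Gaussian prefactor of the Mehler kernel is at most `K u^{-n/2} e^{-(n-δ)u}`. -/
theorem exists_mehler_prefactor_le (n : ℕ) (hn : 1 ≤ n) {δ : ℝ} (hδ : 0 < δ) :
    ∃ K > (0 : ℝ), ∀ u : ℝ, 0 < u →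
      (exp (-2 * u) / (π * (1 - exp (-4 * u)))) ^ ((n : ℝ) / 2) ≤
        K * (u ^ (-((n : ℝ) / 2)) * exp (-((n : ℝ) - δ) * u)) := by
  have hn0 : (0 : ℝ) < n := by exact_mod_cast hn
  set η : ℝ := 2 * δ / n with hη
  have hη0 : 0 < η := by positivity
  set M : ℝ := 1 + 4 / η with hM
  have hM0 : 0 < M := by positivity
  refine ⟨M ^ ((n : ℝ) / 2), by positivity, fun u hu => ?_⟩
  have hgrow : 1 + 4 * u ≤ M * exp (η * u) := by
    have h := add_one_le_exp (η * u)
    have h4 : 4 / η * (η * u) = 4 * u := by field_simp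
    have : M * (η * u + 1) ≤ M * exp (η * u) := by gcongr
    have : 0 < 4 / η := by positivity
    nlinarith [mul_pos hη0 hu]
  have hlt : exp (-4 * u) < 1 := exp_lt_one_iff.2 (by linarith)
  have hinv : exp (4 * u) * exp (-4 * u) = 1 := by rw [← exp_add]; simp
  have hden : 4 * u ≤ (1 + 4 * u) * (1 - exp (-4 * u)) := by
    nlinarith [add_one_le_exp (4 * u), exp_pos (-4 * u)]
  have hbase : exp (-2 * u) / (π * (1 - exp (-4 * u))) ≤ M * (u⁻¹ * exp (-(2 - η) * u)) := by
    have hsplit : exp (-(2 - η) * u) = exp (-2 * u) * exp (η * u) := by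
      rw [← exp_add]; ring_nf
    rw [div_le_iff₀ (by have := pi_pos; nlinarith), hsplit]
    have h1 : u ≤ M * exp (η * u) * (π * (1 - exp (-4 * u))) := by
      calc u ≤ (1 + 4 * u) * (1 - exp (-4 * u)) := by linarith
        _ ≤ (M * exp (η * u)) * (π * (1 - exp (-4 * u))) := by
          gcongr
          nlinarith [pi_gt_three]
    calc exp (-2 * u) = exp (-2 * u) * (u⁻¹ * u) := by field_simp
      _ ≤ exp (-2 * u) * (u⁻¹ * (M * exp (η * u) * (π * (1 - exp (-4 * u))))) := by gcongr
      _ = _ := by ring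
  have hpos : 0 ≤ exp (-2 * u) / (π * (1 - exp (-4 * u))) :=
    div_nonneg (exp_pos _).le (mul_nonneg pi_pos.le (by linarith))
  refine (rpow_le_rpow hpos hbase (by positivity)).trans_eq ?_
  rw [mul_rpow hM0.le (by positivity), mul_rpow (by positivity) (exp_pos _).le,
    inv_rpow hu.le, ← rpow_neg hu.le, ← exp_mul]
  congr 3
  rw [hη]; field_simp

/-- The exponential factor of the Mehler kernel has Gaussian decay, uniformly in time. -/
theorem mehler_exp_factor_le {u r s : ℝ} (hu : 0 < u) :
    exp (-(1 / 4) * ((1 + exp (-2 * u)) / (1 - exp (-2 * u)) * r ^ 2 +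
      (1 - exp (-2 * u)) / (1 + exp (-2 * u)) * s ^ 2)) ≤
      exp (-(1 / 8) * r ^ 2) * exp (-(r ^ 2 / (16 * u))) := by
  rw [← exp_add, exp_le_exp]
  have hlt : exp (-2 * u) < 1 := exp_lt_one_iff.2 (by linarith)
  have hpos := exp_pos (-2 * u)
  have hle := add_one_le_exp (-2 * u)
  have h1 : 1 ≤ (1 + exp (-2 * u)) / (1 - exp (-2 * u)) := by
    rw [le_div_iff₀ (by linarith)]; linarith
  have h2 : 1 / (2 * u) ≤ (1 + exp (-2 * u)) / (1 - exp (-2 * u)) := by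
    rw [div_le_div_iff₀ (by linarith) (by linarith)]; nlinarith
  have h3 : 0 ≤ (1 - exp (-2 * u)) / (1 + exp (-2 * u)) * s ^ 2 :=
    mul_nonneg (div_nonneg (by linarith) (by linarith)) (sq_nonneg s)
  have h4 := mul_le_mul_of_nonneg_right h1 (sq_nonneg r)
  have h5 := mul_le_mul_of_nonneg_right h2 (sq_nonneg r)
  have h6 : r ^ 2 / (16 * u) = 1 / (2 * u) * r ^ 2 / 8 := by field_simp; ring
  rw [h6]
  linarith

theorem exp_neg_sq_div_le {a u r : ℝ} (ha : 0 < a) (hu : 0 < u) (hr : 0 < r) :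
    exp (-(r ^ 2 / (16 * u))) ≤ (16 * a) ^ a * (u ^ a / r ^ (2 * a)) := by
  have h := add_one_le_exp (r ^ 2 / (16 * u) / a)
  have h1 : (r ^ 2 / (16 * u) / a) ^ a ≤ exp (r ^ 2 / (16 * u)) := by
    calc (r ^ 2 / (16 * u) / a) ^ a ≤ (exp (r ^ 2 / (16 * u) / a)) ^ a :=
          rpow_le_rpow (by positivity) (by linarith) ha.le
      _ = _ := by rw [← exp_mul]; field_simp
  have h2 : (r ^ 2 / (16 * u) / a) ^ a = ((16 * a) ^ a * (u ^ a / r ^ (2 * a)))⁻¹ := by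
    rw [rpow_mul hr.le, rpow_two, ← div_rpow hu.le (by positivity),
      ← mul_rpow (by positivity) (by positivity), ← inv_rpow (by positivity)]
    congr 1
    field_simp
  rw [exp_neg]
  rw [h2] at h1
  exact inv_le_of_inv_le₀ (by positivity) h1

theorem exists_W_le (n : ℕ) (hn : 1 ≤ n) {δ : ℝ} (hδ : 0 < δ) :
    ∃ K > (0 : ℝ), ∀ x y : EuclideanSpace ℝ (Fin n), x ≠ y → ∀ u : ℝ, 0 < u →
      W n u x y ≤ K * (exp (-(1 / 8) * ‖x - y‖ ^ 2) / ‖x - y‖ ^ ((n : ℝ) - 1 / 2)) *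
        (u ^ (-(1 : ℝ) / 4) * exp (-((n : ℝ) - δ) * u)) := by
  have hn1 : (1 : ℝ) ≤ n := by exact_mod_cast hn
  obtain ⟨K, hK, hKb⟩ := exists_mehler_prefactor_le n hn hδ
  set a : ℝ := (n : ℝ) / 2 - 1 / 4 with ha
  have ha0 : 0 < a := by linarith
  refine ⟨K * (16 * a) ^ a, by positivity, fun x y hxy u hu => ?_⟩
  have hr : 0 < ‖x - y‖ := norm_pos_iff.2 (sub_ne_zero.2 hxy)
  have hu4 : u ^ (-(1 : ℝ) / 4) = u ^ (-((n : ℝ) / 2)) * u ^ a := by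
    rw [← rpow_add hu]; congr 1; rw [ha]; ring
  have hra : (n : ℝ) - 1 / 2 = 2 * a := by rw [ha]; ring
  rw [W, hu4, hra]
  calc _ ≤ K * (u ^ (-((n : ℝ) / 2)) * exp (-((n : ℝ) - δ) * u)) *
        (exp (-(1 / 8) * ‖x - y‖ ^ 2) * ((16 * a) ^ a * (u ^ a / ‖x - y‖ ^ (2 * a)))) := by
        refine mul_le_mul (hKb u hu) ((mehler_exp_factor_le hu).trans ?_) (exp_pos _).le
          (by positivity)
        gcongr
        exact exp_neg_sq_div_le ha0 hu hr
    _ = _ := by ring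

theorem W_nonneg (n : ℕ) {u : ℝ} (hu : 0 < u) (x y : EuclideanSpace ℝ (Fin n)) :
    0 ≤ W n u x y := by
  have hlt : exp (-4 * u) < 1 := exp_lt_one_iff.2 (by linarith)
  have : 0 ≤ exp (-2 * u) / (π * (1 - exp (-4 * u))) :=
    div_nonneg (exp_pos _).le (mul_nonneg pi_pos.le (by linarith))
  unfold W
  positivity

theorem mul_exp_neg_sq_div_le {t u : ℝ} (hu : 0 < u) :
    t * exp (-t ^ 2 / (4 * u)) ≤ 2 * u ^ ((1 : ℝ) / 2) := by
  rw [← sqrt_eq_rpow, neg_div, exp_neg, ← div_eq_mul_inv, div_le_iff₀ (exp_pos _)]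
  have hs : 0 < √u := sqrt_pos.2 hu
  have hsq : √u ^ 2 = u := sq_sqrt hu.le
  calc t ≤ 2 * √u * (t ^ 2 / (4 * u) + 1) := by
        have : 2 * √u * (t ^ 2 / (4 * u) + 1) = (t ^ 2 + 4 * √u ^ 2) / (2 * √u) := by
          rw [← hsq]; simp only [sqrt_sq hs.le]; field_simp; ring
        rw [this, le_div_iff₀ (by positivity)]
        nlinarith [sq_nonneg (t - √u)]
    _ ≤ _ := by gcongr; exact add_one_le_exp _

theorem abs_exp_neg_mul_sub_one_le {α u : ℝ} (hu : 0 ≤ u) :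
    |exp (-α * u) - 1| ≤ |α| * u * exp (max (-α) 0 * u) := by
  have key : ∀ z : ℝ, |exp z - 1| ≤ |z| * exp (max z 0) := by
    intro z
    rcases le_total 0 z with hz | hz
    · rw [max_eq_left hz, abs_of_nonneg hz, abs_of_nonneg (by linarith [add_one_le_exp z])]
      have h := add_one_le_exp (-z)
      have : exp z * exp (-z) = 1 := by rw [← exp_add]; simp
      nlinarith [exp_pos z]
    · rw [max_eq_right hz, abs_of_nonpos hz, abs_of_nonpos (by linarith [exp_le_one_iff.2 hz])]
      simp only [exp_zero, mul_one]
      linarith [add_one_le_exp z]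
  have h := key (-α * u)
  rwa [abs_mul, abs_neg, abs_of_nonneg hu, ← zero_mul u, ← max_mul_of_nonneg _ _ hu] at h

theorem exists_abs_Lker_le (n : ℕ) (hn : 1 ≤ n) (α : ℝ) (hα : -(n : ℝ) < α) :
    ∃ C > (0 : ℝ), ∀ x y : EuclideanSpace ℝ (Fin n), x ≠ y → ∀ t : ℝ, 0 < t →
      |Lker n α x y t| ≤
        C * exp (-(1 / 8) * ‖x - y‖ ^ 2) / ‖x - y‖ ^ ((n : ℝ) - 1 / 2) := by
  have hn0 : (0 : ℝ) < n := by exact_mod_cast hn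
  set β : ℝ := max (-α) 0 with hβ
  have hβn : β < n := max_lt (by linarith) hn0
  set δ : ℝ := ((n : ℝ) - β) / 2 with hδ
  have hδ0 : 0 < δ := by linarith
  obtain ⟨K, hK, hW⟩ := exists_W_le n hn hδ0
  have hint : IntegrableOn (fun u : ℝ => u ^ (-(1 : ℝ) / 4) * exp (-δ * u)) (Ioi 0) := by
    have h := integrableOn_rpow_mul_exp_neg_mul_rpow (s := -(1 : ℝ) / 4) (p := 1) (b := δ)
      (by norm_num) one_pos hδ0
    simpa only [rpow_one] using h
  set J : ℝ := ∫ u in Ioi (0 : ℝ), u ^ (-(1 : ℝ) / 4) * exp (-δ * u) with hJ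
  have hJ0 : 0 ≤ J := setIntegral_nonneg measurableSet_Ioi fun u hu => by
    have : (0 : ℝ) < u := hu
    positivity
  refine ⟨2 * |α| * K * J + 1, by positivity, fun x y hxy t ht => ?_⟩
  have hr : 0 < ‖x - y‖ := norm_pos_iff.2 (sub_ne_zero.2 hxy)
  set G : ℝ := exp (-(1 / 8) * ‖x - y‖ ^ 2) / ‖x - y‖ ^ ((n : ℝ) - 1 / 2) with hG
  have hG0 : 0 < G := by positivity
  have hpt : ∀ u ∈ Ioi (0 : ℝ),
      ‖t * (u ^ (-(3 : ℝ) / 2) * exp (-t ^ 2 / (4 * u)) * (exp (-α * u) - 1) * W n u x y)‖ ≤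
        2 * |α| * K * G * (u ^ (-(1 : ℝ) / 4) * exp (-δ * u)) := by
    intro u hu
    have hu : (0 : ℝ) < u := hu
    have hWn := W_nonneg n hu x y
    have hcancel : u ^ (-(3 : ℝ) / 2) * u ^ ((1 : ℝ) / 2) * u = 1 := by
      rw [← rpow_add hu]
      norm_num
      rw [rpow_neg_one]
      field_simp
    have hexp : exp (β * u) * exp (-((n : ℝ) - δ) * u) = exp (-δ * u) := by
      rw [← exp_add]; congr 1; rw [hδ]; ring
    calc _ = u ^ (-(3 : ℝ) / 2) * (t * exp (-t ^ 2 / (4 * u))) * |exp (-α * u) - 1| *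
          W n u x y := by
          rw [norm_eq_abs, abs_mul, abs_mul, abs_mul, abs_mul, abs_of_pos ht, abs_of_nonneg hWn,
            abs_of_pos (rpow_pos_of_pos hu _), abs_of_pos (exp_pos _)]
          ring
      _ ≤ u ^ (-(3 : ℝ) / 2) * (2 * u ^ ((1 : ℝ) / 2)) * (|α| * u * exp (β * u)) *
          (K * G * (u ^ (-(1 : ℝ) / 4) * exp (-((n : ℝ) - δ) * u))) := by
          have ht' := mul_exp_neg_sq_div_le (t := t) hu
          have hα' := abs_exp_neg_mul_sub_one_le (α := α) hu.le
          exact mul_le_mul (mul_le_mul (mul_le_mul_of_nonneg_left ht' (by positivity)) hα'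
            (abs_nonneg _) (by positivity)) (hW x y hxy u hu) hWn (by positivity)
      _ = (u ^ (-(3 : ℝ) / 2) * u ^ ((1 : ℝ) / 2) * u) * (2 * |α| * K * G *
          (u ^ (-(1 : ℝ) / 4) * (exp (β * u) * exp (-((n : ℝ) - δ) * u)))) := by ring
      _ = _ := by rw [hcancel, hexp, one_mul]
  have hbound := norm_integral_le_of_norm_le (hint.const_mul (2 * |α| * K * G))
    ((ae_restrict_iff' measurableSet_Ioi).2 (Filter.Eventually.of_forall hpt))
  rw [integral_const_mul, integral_const_mul, ← hJ, norm_eq_abs] at hbound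
  have hsqrt : 1 ≤ √(4 * π) := by
    rw [one_le_sqrt]; linarith [pi_gt_three]
  rw [Lker, div_mul_eq_mul_div, abs_div, abs_of_pos (by linarith : 0 < √(4 * π)), mul_div_assoc]
  calc _ ≤ _ := div_le_self (abs_nonneg _) hsqrt
    _ ≤ _ := hbound
    _ ≤ (2 * |α| * K * J + 1) * G := by linarith

theorem integrable_exp_neg_mul_norm_sq_div_norm_rpow (n : ℕ) (hn : 1 ≤ n) {c : ℝ} (hc : 0 < c)
    (C : ℝ) :
    Integrable fun x : EuclideanSpace ℝ (Fin n) =>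
      C * exp (-c * ‖x‖ ^ 2) / ‖x‖ ^ ((n : ℝ) - 1 / 2) := by
  have : Nonempty (Fin n) := ⟨⟨0, hn⟩⟩
  rw [integrable_fun_norm_addHaar volume
    (f := fun r : ℝ => C * exp (-c * r ^ 2) / r ^ ((n : ℝ) - 1 / 2)), finrank_euclideanSpace_fin]
  refine IntegrableOn.congr_fun ((integrableOn_rpow_mul_exp_neg_mul_sq hc
    (s := -(1 : ℝ) / 2) (by norm_num)).const_mul C) (fun r hr => ?_) measurableSet_Ioi
  have hr : (0 : ℝ) < r := hr
  have hsplit : r ^ (n - 1) = r ^ (-(1 : ℝ) / 2) * r ^ ((n : ℝ) - 1 / 2) := by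
    rw [← rpow_add hr, ← rpow_natCast, Nat.cast_sub hn]
    congr 1
    push_cast
    ring
  simp only [smul_eq_mul]
  rw [hsplit]
  field_simp

theorem Lker_bound (n : ℕ) (hn : 1 ≤ n) (α : ℝ) (hα : -(n : ℝ) < α) :
    ∃ C > (0 : ℝ), ∃ c > (0 : ℝ),
      (∀ x y : EuclideanSpace ℝ (Fin n), x ≠ y → ∀ t : ℝ, 0 < t →
        |Lker n α x y t| ≤
          C * Real.exp (-c * ‖x - y‖ ^ 2) / ‖x - y‖ ^ ((n : ℝ) - 1 / 2)) ∧
      ∃ C' > (0 : ℝ), ∀ y : EuclideanSpace ℝ (Fin n),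
        (∫ x : EuclideanSpace ℝ (Fin n),
          ⨆ (t : ℝ) (_ : (0 : ℝ) < t), |Lker n α x y t|) ≤ C' := by
  obtain ⟨C, hC, hL⟩ := exists_abs_Lker_le n hn α hα
  refine ⟨C, hC, 1 / 8, by norm_num, hL, ?_⟩
  have : Nonempty (Fin n) := ⟨⟨0, hn⟩⟩
  set g : EuclideanSpace ℝ (Fin n) → ℝ := fun x =>
    C * exp (-(1 / 8) * ‖x‖ ^ 2) / ‖x‖ ^ ((n : ℝ) - 1 / 2) with hg
  have hgi : Integrable g :=
    integrable_exp_neg_mul_norm_sq_div_norm_rpow n hn (by norm_num) C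
  have hg0 : ∀ x, 0 ≤ g x := fun x => by rw [hg]; positivity
  refine ⟨(∫ x, g x) + 1, by have := integral_nonneg (μ := volume) (f := g) hg0; linarith, fun y => ?_⟩
  calc _ ≤ ∫ x, g (x - y) := by
        refine integral_mono_of_nonneg (Filter.Eventually.of_forall fun x =>
          Real.iSup_nonneg fun t => Real.iSup_nonneg fun _ => abs_nonneg _)
          (hgi.comp_sub_right y) ?_
        filter_upwards [Measure.ae_ne volume y] with x hxy
        exact Real.iSup_le (fun t => Real.iSup_le (fun ht => hL x y hxy t ht) (hg0 _)) (hg0 _)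
    _ = ∫ x, g x := integral_sub_right_eq_self g y
    _ ≤ _ := by linarith
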